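/- (Iterates of vanilla landing stay in the safe region) Let ε ∈ (0, 3/4), λ > 0, L' > 0, and let f : ℝ^{n×p} → ℝ be differentiable with ‖∇f(X)‖_F ≤ L' for every X ∈ St(p,n)^ε. Let γ_s := min{ λ(1−ε)ε / ((1+ε)²(L')² + λ²(1+ε)ε²), √(ε / (2(1+ε)²(L')²)), 1/(2λ) }, fix 0 ≤ γ ≤ γ_s, X⁰ ∈ St(p,n)^ε, and define X^{k+1} := X^k − γ·( skew(∇f(X^k)(X^k)ᵀ)X^k + λX^k((X^k)ᵀX^k − I_p) ). Then X^k ∈ St(p,n)^ε for every k ≥ 0. -/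

import Mathlib

open Matrix Finset

noncomputable section

/-- Frobenius inner product `⟨A, B⟩ = Tr (Aᵀ * B)`. -/
def finner {n p : ℕ} (A B : Matrix (Fin n) (Fin p) ℝ) : ℝ :=
  (Aᵀ * B).trace

/-- Frobenius norm `‖A‖_F = √(Tr (Aᵀ * A))`. -/
def fnorm {n p : ℕ} (A : Matrix (Fin n) (Fin p) ℝ) : ℝ :=
  Real.sqrt ((Aᵀ * A).trace)

/-- Skew-symmetric part `skew M = (M - Mᵀ)/2`. -/
def skewPart {m : ℕ} (M : Matrix (Fin m) (Fin m) ℝ) : Matrix (Fin m) (Fin m) ℝ :=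
  (1 / 2 : ℝ) • (M - Mᵀ)

/-- Symmetric part `sym M = (M + Mᵀ)/2`. -/
def symPart {m : ℕ} (M : Matrix (Fin m) (Fin m) ℝ) : Matrix (Fin m) (Fin m) ℝ :=
  (1 / 2 : ℝ) • (M + Mᵀ)

/-- Penalty function `N(X) = ‖XᵀX - I‖_F² / 4`. -/
def penaltyN {n p : ℕ} (X : Matrix (Fin n) (Fin p) ℝ) : ℝ :=
  (1 / 4 : ℝ) * fnorm (Xᵀ * X - 1) ^ 2

/-- Landing direction `Λ̃(X; g) = skew(g Xᵀ) X + λ X (XᵀX - I)` with gradient estimate `g`. -/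
def landingDir {n p : ℕ} (lam : ℝ) (X g : Matrix (Fin n) (Fin p) ℝ) :
    Matrix (Fin n) (Fin p) ℝ :=
  skewPart (g * Xᵀ) * X + lam • (X * (Xᵀ * X - 1))

attribute [local instance] Matrix.frobeniusNormedAddCommGroup Matrix.frobeniusNormedSpace

theorem frobenius_norm_sq_eq_trace {m k : ℕ} (A : Matrix (Fin m) (Fin k) ℝ) :
    ‖A‖ ^ 2 = (Aᵀ * A).trace := by
  rw [Matrix.frobenius_norm_def, ← Real.sqrt_eq_rpow, Real.sq_sqrt (by positivity),
    Finset.sum_comm]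
  simp [Matrix.trace, Matrix.mul_apply, pow_two]

theorem fnorm_eq_norm {m k : ℕ} (A : Matrix (Fin m) (Fin k) ℝ) : fnorm A = ‖A‖ := by
  rw [fnorm, ← frobenius_norm_sq_eq_trace, Real.sqrt_sq (norm_nonneg A)]

theorem trace_transpose_mul_le_norm_mul_norm {m k : ℕ} (A B : Matrix (Fin m) (Fin k) ℝ) :
    (Aᵀ * B).trace ≤ ‖A‖ * ‖B‖ := by
  have hsum (C D : Matrix (Fin m) (Fin k) ℝ) :
      (Cᵀ * D).trace = ∑ x : Fin k × Fin m, C x.2 x.1 * D x.2 x.1 := by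
    simp [Matrix.trace, Matrix.mul_apply, Fintype.sum_prod_type]
  refine abs_le_of_sq_le_sq' ?_ (by positivity) |>.2
  rw [mul_pow, frobenius_norm_sq_eq_trace, frobenius_norm_sq_eq_trace, hsum, hsum, hsum]
  simpa only [pow_two] using
    Finset.sum_mul_sq_le_sq_mul_sq Finset.univ (fun x : Fin k × Fin m => A x.2 x.1)
      (fun x => B x.2 x.1)

theorem norm_mul_sq_le_of_gram {m k l : ℕ} (X : Matrix (Fin m) (Fin k) ℝ)
    (M : Matrix (Fin k) (Fin l) ℝ) :
    ‖X * M‖ ^ 2 ≤ (1 + ‖Xᵀ * X - 1‖) * ‖M‖ ^ 2 := by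
  have hgram : (X * M)ᵀ * (X * M) = Mᵀ * M + Mᵀ * ((Xᵀ * X - 1) * M) := by
    simp [Matrix.transpose_mul, Matrix.mul_assoc, Matrix.sub_mul, Matrix.mul_sub]
  have hcs := trace_transpose_mul_le_norm_mul_norm M ((Xᵀ * X - 1) * M)
  have hmul := mul_le_mul_of_nonneg_left (Matrix.frobenius_norm_mul (Xᵀ * X - 1) M)
    (norm_nonneg M)
  rw [frobenius_norm_sq_eq_trace, hgram, Matrix.trace_add, ← frobenius_norm_sq_eq_trace]
  linarith

theorem norm_transpose_mul_sq_le_of_gram {m k l : ℕ} (X : Matrix (Fin m) (Fin k) ℝ)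
    (M : Matrix (Fin m) (Fin l) ℝ) :
    ‖Xᵀ * M‖ ^ 2 ≤ (1 + ‖Xᵀ * X - 1‖) * ‖M‖ ^ 2 := by
  have hcs : ‖Xᵀ * M‖ ^ 2 ≤ ‖M‖ * ‖X * (Xᵀ * M)‖ := by
    rw [frobenius_norm_sq_eq_trace]
    simpa [Matrix.transpose_mul, Matrix.mul_assoc] using
      trace_transpose_mul_le_norm_mul_norm M (X * (Xᵀ * M))
  have hX := norm_mul_sq_le_of_gram X (Xᵀ * M)
  rcases (sq_nonneg ‖Xᵀ * M‖).eq_or_lt with h0 | hpos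
  · rw [← h0]
    positivity
  · refine le_of_mul_le_mul_right ?_ hpos
    calc ‖Xᵀ * M‖ ^ 2 * ‖Xᵀ * M‖ ^ 2 ≤ (‖M‖ * ‖X * (Xᵀ * M)‖) * (‖M‖ * ‖X * (Xᵀ * M)‖) :=
          mul_self_le_mul_self hpos.le hcs
      _ = ‖M‖ ^ 2 * ‖X * (Xᵀ * M)‖ ^ 2 := by ring
      _ ≤ ‖M‖ ^ 2 * ((1 + ‖Xᵀ * X - 1‖) * ‖Xᵀ * M‖ ^ 2) := by gcongr
      _ = (1 + ‖Xᵀ * X - 1‖) * ‖M‖ ^ 2 * ‖Xᵀ * M‖ ^ 2 := by ring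

theorem norm_mul_right_sq_le_of_gram {m k l : ℕ} (X : Matrix (Fin m) (Fin k) ℝ)
    (M : Matrix (Fin l) (Fin m) ℝ) :
    ‖M * X‖ ^ 2 ≤ (1 + ‖Xᵀ * X - 1‖) * ‖M‖ ^ 2 := by
  have h := norm_transpose_mul_sq_le_of_gram X Mᵀ
  rwa [← Matrix.transpose_mul, Matrix.frobenius_norm_transpose,
    Matrix.frobenius_norm_transpose] at h

theorem norm_mul_transpose_sq_le_of_gram {m k l : ℕ} (X : Matrix (Fin m) (Fin k) ℝ)
    (M : Matrix (Fin l) (Fin k) ℝ) :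
    ‖M * Xᵀ‖ ^ 2 ≤ (1 + ‖Xᵀ * X - 1‖) * ‖M‖ ^ 2 := by
  have h := norm_mul_sq_le_of_gram X Mᵀ
  rwa [← Matrix.frobenius_norm_transpose, Matrix.transpose_mul, Matrix.transpose_transpose,
    Matrix.frobenius_norm_transpose M] at h

theorem transpose_skewPart {m : ℕ} (M : Matrix (Fin m) (Fin m) ℝ) :
    (skewPart M)ᵀ = -skewPart M := by
  simp [skewPart, ← smul_neg]

theorem norm_skewPart_le {m : ℕ} (M : Matrix (Fin m) (Fin m) ℝ) : ‖skewPart M‖ ≤ ‖M‖ := by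
  have h := norm_sub_le M Mᵀ
  rw [Matrix.frobenius_norm_transpose] at h
  rw [skewPart, norm_smul, Real.norm_of_nonneg (by norm_num)]
  linarith

theorem gram_landing_step {n p : ℕ} (lam γ : ℝ) (X g : Matrix (Fin n) (Fin p) ℝ) :
    (X - γ • landingDir lam X g)ᵀ * (X - γ • landingDir lam X g) - 1 =
      (1 - 2 * γ * lam) • (Xᵀ * X - 1) - (2 * γ * lam) • ((Xᵀ * X - 1) * (Xᵀ * X - 1)) +
        γ ^ 2 • ((landingDir lam X g)ᵀ * landingDir lam X g) := by
  have hcross : Xᵀ * landingDir lam X g + (landingDir lam X g)ᵀ * X =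
      (2 * lam) • ((Xᵀ * X - 1) + (Xᵀ * X - 1) * (Xᵀ * X - 1)) := by
    simp only [landingDir, Matrix.transpose_add, Matrix.transpose_mul, Matrix.transpose_smul,
      Matrix.transpose_sub, Matrix.transpose_transpose, transpose_skewPart,
      Matrix.mul_add, Matrix.add_mul, Matrix.mul_sub, Matrix.sub_mul, Matrix.mul_one,
      Matrix.one_mul, Matrix.mul_smul, Matrix.smul_mul, Matrix.mul_neg, Matrix.neg_mul,
      Matrix.mul_assoc]
    module
  have hexpand : (X - γ • landingDir lam X g)ᵀ * (X - γ • landingDir lam X g) =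
      Xᵀ * X - γ • (Xᵀ * landingDir lam X g + (landingDir lam X g)ᵀ * X) +
        γ ^ 2 • ((landingDir lam X g)ᵀ * landingDir lam X g) := by
    simp only [Matrix.transpose_sub, Matrix.transpose_smul, Matrix.mul_sub, Matrix.sub_mul,
      Matrix.mul_smul, Matrix.smul_mul]
    module
  rw [hexpand, hcross]
  module

theorem norm_landingDir_sq {n p : ℕ} (lam : ℝ) (X g : Matrix (Fin n) (Fin p) ℝ) :
    ‖landingDir lam X g‖ ^ 2 =
      ‖skewPart (g * Xᵀ) * X‖ ^ 2 + lam ^ 2 * ‖X * (Xᵀ * X - 1)‖ ^ 2 := by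
  set A := skewPart (g * Xᵀ) with hA
  set D := Xᵀ * X - 1 with hD
  have hAt : Aᵀ = -A := transpose_skewPart _
  have hDt : Dᵀ = D := by simp [hD, Matrix.transpose_mul]
  have horth : ((A * X)ᵀ * (X * D)).trace = 0 := by
    have h1 : ((A * X)ᵀ * (X * D)).trace = -((Xᵀ * A * X) * D).trace := by
      simp [Matrix.transpose_mul, hAt, Matrix.mul_assoc]
    have h2 : ((Xᵀ * A * X) * D).trace = -((Xᵀ * A * X) * D).trace := by
      conv_lhs => rw [← Matrix.trace_transpose]
      rw [Matrix.transpose_mul, hDt, Matrix.trace_mul_comm]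
      simp [Matrix.transpose_mul, hAt, Matrix.mul_assoc]
    linarith
  have horth' : ((X * D)ᵀ * (A * X)).trace = 0 := by
    rw [← Matrix.trace_transpose, Matrix.transpose_mul, Matrix.transpose_transpose, horth]
  rw [frobenius_norm_sq_eq_trace, frobenius_norm_sq_eq_trace, frobenius_norm_sq_eq_trace,
    landingDir, ← hA, ← hD]
  simp only [Matrix.transpose_add, Matrix.transpose_smul, Matrix.add_mul, Matrix.mul_add,
    Matrix.smul_mul, Matrix.mul_smul, Matrix.trace_add, Matrix.trace_smul, smul_eq_mul,
    horth, horth']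
  ring

theorem norm_landingDir_sq_le {n p : ℕ} (lam : ℝ) (X g : Matrix (Fin n) (Fin p) ℝ) :
    ‖landingDir lam X g‖ ^ 2 ≤
      (1 + ‖Xᵀ * X - 1‖) ^ 2 * ‖g‖ ^ 2 +
        lam ^ 2 * (1 + ‖Xᵀ * X - 1‖) * ‖Xᵀ * X - 1‖ ^ 2 := by
  have hrel : ‖skewPart (g * Xᵀ) * X‖ ^ 2 ≤ (1 + ‖Xᵀ * X - 1‖) ^ 2 * ‖g‖ ^ 2 :=
    calc ‖skewPart (g * Xᵀ) * X‖ ^ 2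
        ≤ (1 + ‖Xᵀ * X - 1‖) * ‖skewPart (g * Xᵀ)‖ ^ 2 := norm_mul_right_sq_le_of_gram _ _
      _ ≤ (1 + ‖Xᵀ * X - 1‖) * ‖g * Xᵀ‖ ^ 2 := by
          gcongr
          exact norm_skewPart_le _
      _ ≤ (1 + ‖Xᵀ * X - 1‖) * ((1 + ‖Xᵀ * X - 1‖) * ‖g‖ ^ 2) := by
          gcongr
          exact norm_mul_transpose_sq_le_of_gram _ _
      _ = (1 + ‖Xᵀ * X - 1‖) ^ 2 * ‖g‖ ^ 2 := by ring
  have hpen := mul_le_mul_of_nonneg_left (norm_mul_sq_le_of_gram X (Xᵀ * X - 1)) (sq_nonneg lam)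
  rw [norm_landingDir_sq]
  linarith

theorem norm_gram_landing_step_le {n p : ℕ} {lam γ : ℝ} (X g : Matrix (Fin n) (Fin p) ℝ)
    (hlam : 0 ≤ lam) (hγ0 : 0 ≤ γ) (hγ : 2 * γ * lam ≤ 1) :
    ‖(X - γ • landingDir lam X g)ᵀ * (X - γ • landingDir lam X g) - 1‖ ≤
      (1 - 2 * γ * lam) * ‖Xᵀ * X - 1‖ + 2 * γ * lam * ‖Xᵀ * X - 1‖ ^ 2 +
        γ ^ 2 * ‖landingDir lam X g‖ ^ 2 := by
  have hΔ := Matrix.frobenius_norm_mul (Xᵀ * X - 1) (Xᵀ * X - 1)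
  have hΛ := Matrix.frobenius_norm_mul (landingDir lam X g)ᵀ (landingDir lam X g)
  rw [Matrix.frobenius_norm_transpose] at hΛ
  rw [gram_landing_step, pow_two ‖_‖, pow_two ‖_‖]
  refine norm_add_le_of_le (norm_sub_le_of_le ?_ ?_) ?_
  · rw [norm_smul, Real.norm_of_nonneg (by linarith)]
  · rw [norm_smul, Real.norm_of_nonneg (by positivity)]
    gcongr
  · rw [norm_smul, Real.norm_of_nonneg (by positivity)]
    gcongr

/-- The one-step bound is convex in the distance `d`, so it suffices to control it at the
endpoints `0` and `ε`. -/
theorem step_bound_le_of_endpoints {ε lam γ G d : ℝ} (hε : 0 < ε) (hlam : 0 ≤ lam) (hγ0 : 0 ≤ γ)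
    (hd0 : 0 ≤ d) (hd : d ≤ ε) (hzero : γ ^ 2 * G ≤ ε)
    (hend : γ * (G + lam ^ 2 * (1 + ε) * ε ^ 2) ≤ lam * (1 - ε) * ε)
    (hε1 : ε ≤ 1) :
    (1 - 2 * γ * lam) * d + 2 * γ * lam * d ^ 2 +
      γ ^ 2 * (G + lam ^ 2 * (1 + ε) * d ^ 2) ≤ ε := by
  have hend' : γ ^ 2 * (G + lam ^ 2 * (1 + ε) * ε ^ 2) ≤ 2 * γ * lam * (1 - ε) * ε := by
    have h1 := mul_le_mul_of_nonneg_left hend hγ0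
    have h2 : 0 ≤ γ * lam * (1 - ε) * ε :=
      mul_nonneg (mul_nonneg (mul_nonneg hγ0 hlam) (by linarith)) hε.le
    linarith
  set K := 2 * γ * lam + γ ^ 2 * (lam ^ 2 * (1 + ε)) with hK
  have hK0 : 0 ≤ K := by positivity
  have hchord : K * (d * d) ≤ K * (d * ε) := by gcongr
  refine le_of_mul_le_mul_left ?_ hε
  have h0 := mul_le_mul_of_nonneg_left hzero (sub_nonneg.2 hd)
  have h1 := mul_le_mul_of_nonneg_left hend' hd0
  have h2 := mul_le_mul_of_nonneg_left hchord hε.le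
  rw [hK] at h2
  linarith

/-- iterates of vanilla landing stay in the safe region. -/
theorem landing_iterates_stay_safe {n p : ℕ} (ε lam L' γ : ℝ)
    (hε : ε ∈ Set.Ioo (0 : ℝ) (3 / 4)) (hlam : 0 < lam) (hL' : 0 < L')
    (f : Matrix (Fin n) (Fin p) ℝ → ℝ)
    (gradf : Matrix (Fin n) (Fin p) ℝ → Matrix (Fin n) (Fin p) ℝ)
    (hdiff : Differentiable ℝ f)
    (hgrad : ∀ Y H : Matrix (Fin n) (Fin p) ℝ, fderiv ℝ f Y H = finner (gradf Y) H)
    (hgb : ∀ X : Matrix (Fin n) (Fin p) ℝ, fnorm (Xᵀ * X - 1) ≤ ε → fnorm (gradf X) ≤ L')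
    (hγ0 : 0 ≤ γ)
    (hγ : γ ≤ min (lam * (1 - ε) * ε / ((1 + ε) ^ 2 * L' ^ 2 + lam ^ 2 * (1 + ε) * ε ^ 2))
      (min (Real.sqrt (ε / (2 * (1 + ε) ^ 2 * L' ^ 2))) (1 / (2 * lam))))
    (X : ℕ → Matrix (Fin n) (Fin p) ℝ)
    (hX0 : fnorm ((X 0)ᵀ * X 0 - 1) ≤ ε)
    (hrec : ∀ k, X (k + 1) = X k - γ • landingDir lam (X k) (gradf (X k))) :
    ∀ k, fnorm ((X k)ᵀ * X k - 1) ≤ ε := by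
  obtain ⟨hε0, hε1⟩ := hε
  obtain ⟨hγ1, hγ23⟩ := le_min_iff.1 hγ
  obtain ⟨hγ2, hγ3⟩ := le_min_iff.1 hγ23
  rw [le_div_iff₀ (by positivity)] at hγ1 hγ3
  have hzero : γ ^ 2 * ((1 + ε) ^ 2 * L' ^ 2) ≤ ε := by
    rw [Real.le_sqrt hγ0 (by positivity), le_div_iff₀ (by positivity)] at hγ2
    nlinarith
  intro k
  induction k with
  | zero => exact hX0
  | succ k ih =>
    have hg := hgb (X k) ih
    rw [fnorm_eq_norm] at ih hg ⊢
    rw [hrec k]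
    refine (norm_gram_landing_step_le (X k) (gradf (X k)) hlam.le hγ0 (by linarith)).trans ?_
    refine le_trans ?_ (step_bound_le_of_endpoints hε0 hlam.le hγ0 (norm_nonneg _) ih hzero hγ1
      (by linarith))
    gcongr
    refine (norm_landingDir_sq_le lam (X k) (gradf (X k))).trans ?_
    gcongr
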